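/- Let q ∈ ℝ with 0 < q < 1, and let (a_n)_{n≥1} be complex numbers with Σ_{n=1}^∞ |a_n| < ∞. Define g(φ) := Σ_{n=1}^∞ a_n cos(2nφ). Then ∫_0^π g(φ) · log( ϑ₄(φ,q) / ϑ₄(0,q) ) dφ = −π Σ_{n=1}^∞ a_n q^n / ( n (1 − q^{2n}) ). -/

import Mathlib

/-- The Jacobi theta function `ϑ₄(u,Q) = Σ_{n∈ℤ} (-1)^n Q^{n²} e^{2inu}`. -/
noncomputable def theta4 (u Q : ℂ) : ℂ :=
  ∑' n : ℤ, (-1 : ℂ) ^ n * Q ^ (n ^ 2) * Complex.exp (2 * Complex.I * n * u)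

open Filter Topology

/-- The `q`-Pochhammer symbol `(p; p)_k`. -/
noncomputable def qPoch (p : ℂ) (k : ℕ) : ℂ := ∏ i ∈ Finset.range k, (1 - p ^ (i + 1))

/-- The reciprocal of `(p; p)_n`, extended by zero to negative indices. -/
noncomputable def invQPoch (p : ℂ) : ℤ → ℂ
  | Int.ofNat k => (qPoch p k)⁻¹
  | Int.negSucc _ => 0

/-- The coefficient of `z ^ n` in `∏ m < N, (1 - q ^ (2m+1) z) (1 - q ^ (2m+1) z⁻¹)`. -/
noncomputable def tripleCoeff (q : ℂ) (N : ℕ) (n : ℤ) : ℂ :=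
  (-1) ^ n * q ^ (n ^ 2) * qPoch (q ^ 2) (2 * N) *
    (invQPoch (q ^ 2) (N + n) * invQPoch (q ^ 2) (N - n))

lemma one_sub_pow_ne_zero {p : ℂ} (hp : ‖p‖ < 1) {k : ℕ} (hk : k ≠ 0) : 1 - p ^ k ≠ 0 := by
  intro h
  have h1 : ‖p ^ k‖ < 1 := by
    rw [norm_pow]; exact pow_lt_one₀ (norm_nonneg _) hp hk
  rw [← sub_eq_zero.mp h] at h1
  simp at h1

lemma invQPoch_sub_one {p : ℂ} (hp : ‖p‖ < 1) (n : ℤ) :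
    invQPoch p (n - 1) = (1 - p ^ n) * invQPoch p n := by
  rcases n with k | k
  · rcases k with _ | k
    · rw [show Int.ofNat 0 - 1 = Int.negSucc 0 from rfl]
      simp [invQPoch]
    · have h : Int.ofNat (k + 1) - 1 = Int.ofNat k := by simp
      have h0 := one_sub_pow_ne_zero hp k.succ_ne_zero
      rw [h]
      simp only [invQPoch, qPoch, Finset.prod_range_succ, Int.ofNat_eq_natCast, zpow_natCast,
        mul_inv]
      rw [mul_comm, mul_assoc, inv_mul_cancel₀ h0, mul_one]
  · have h : Int.negSucc k - 1 = Int.negSucc (k + 1) := by omega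
    rw [h]
    simp [invQPoch]

lemma tripleCoeff_succ {q : ℂ} (hq0 : q ≠ 0) (hq : ‖q‖ < 1) (N : ℕ) (n : ℤ) :
    tripleCoeff q (N + 1) n = (1 + (q ^ (2 * N + 1)) ^ 2) * tripleCoeff q N n -
      q ^ (2 * N + 1) * (tripleCoeff q N (n - 1) + tripleCoeff q N (n + 1)) := by
  have hp : ‖q ^ 2‖ < 1 := by
    rw [norm_pow]; exact pow_lt_one₀ (norm_nonneg _) hq two_ne_zero
  have h1 := invQPoch_sub_one hp (N + n + 1)
  have h2 := invQPoch_sub_one hp (N + n)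
  have h3 := invQPoch_sub_one hp (N - n + 1)
  have h4 := invQPoch_sub_one hp (N - n)
  rw [add_sub_cancel_right] at h1 h3
  have e1 : ((N + 1 : ℕ) : ℤ) + n = N + n + 1 := by push_cast; ring
  have e2 : ((N + 1 : ℕ) : ℤ) - n = N - n + 1 := by push_cast; ring
  have e3 : (N : ℤ) + (n - 1) = N + n - 1 := by ring
  have e4 : (N : ℤ) - (n - 1) = N - n + 1 := by ring
  have e5 : (N : ℤ) + (n + 1) = N + n + 1 := by ring
  have e6 : (N : ℤ) - (n + 1) = N - n - 1 := by ring
  have hm : (-1 : ℂ) ≠ 0 := by norm_num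
  have s1 : (-1 : ℂ) ^ (n - 1) = -(-1) ^ n := by rw [zpow_sub_one₀ hm]; norm_num
  have s2 : (-1 : ℂ) ^ (n + 1) = -(-1) ^ n := by rw [zpow_add_one₀ hm]; norm_num
  have hw : q ^ n ≠ 0 := zpow_ne_zero _ hq0
  have t1 : q ^ ((n - 1) ^ 2) = q ^ (n ^ 2) * q / (q ^ n) ^ 2 := by
    rw [show (n - 1) ^ 2 = n ^ 2 + 1 - (n + n) by ring, zpow_sub₀ hq0, zpow_add₀ hq0 n n,
      zpow_add_one₀ hq0, sq (q ^ n)]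
  have t2 : q ^ ((n + 1) ^ 2) = q ^ (n ^ 2) * q * (q ^ n) ^ 2 := by
    rw [show (n + 1) ^ 2 = n ^ 2 + 1 + (n + n) by ring, zpow_add₀ hq0, zpow_add₀ hq0 n n,
      zpow_add_one₀ hq0, sq (q ^ n)]
  have hp0 : q ^ 2 ≠ 0 := pow_ne_zero _ hq0
  have hc : (q ^ 2) ^ n = (q ^ n) ^ 2 := by
    rw [← zpow_natCast, ← zpow_natCast, zpow_comm]
  have hd : (q ^ 2) ^ N = (q ^ N) ^ 2 := by ring
  have hP : qPoch (q ^ 2) (2 * (N + 1)) = qPoch (q ^ 2) (2 * N) *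
      (1 - (q ^ 2) ^ (2 * N + 1)) * (1 - (q ^ 2) ^ (2 * N + 2)) := by
    simp only [qPoch, mul_add, mul_one, Finset.prod_range_succ]
  simp only [tripleCoeff, e1, e2, e3, e4, e5, e6, s1, s2, t1, t2, h2, h4, hP]
  rw [h1, h3]
  simp only [zpow_add₀ hp0, zpow_sub₀ hp0, zpow_one, zpow_natCast, hc, hd]
  generalize q ^ n = w at *
  generalize invQPoch (q ^ 2) _ = E
  generalize invQPoch (q ^ 2) _ = F
  have e7 : q ^ (2 * N + 1) = (q ^ N) ^ 2 * q := by ring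
  have e8 : (q ^ 2) ^ (2 * N + 1) = (q ^ N) ^ 4 * q ^ 2 := by ring
  have e9 : (q ^ 2) ^ (2 * N + 2) = (q ^ N) ^ 4 * q ^ 4 := by ring
  rw [e7, e8, e9]
  generalize q ^ N = Q
  field_simp
  ring

lemma hasSum_tripleCoeff {q : ℂ} (hq0 : q ≠ 0) (hq : ‖q‖ < 1) {z : ℂ} (hz : z ≠ 0) (N : ℕ) :
    HasSum (fun n : ℤ => tripleCoeff q N n * z ^ n)
      (∏ m ∈ Finset.range N, (1 - q ^ (2 * m + 1) * z) * (1 - q ^ (2 * m + 1) * z⁻¹)) := by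
  induction N with
  | zero =>
    have h0 : invQPoch (q ^ 2) 0 = 1 := by
      change (qPoch (q ^ 2) 0)⁻¹ = 1
      simp [qPoch]
    have h : tripleCoeff q 0 0 * z ^ (0 : ℤ) = 1 := by simp [tripleCoeff, qPoch, h0]
    rw [Finset.prod_range_zero, ← h]
    refine hasSum_single (0 : ℤ) ?_
    rintro (k | k) hk
    · obtain ⟨j, rfl⟩ := Nat.exists_eq_succ_of_ne_zero (n := k) (by rintro rfl; simp at hk)
      have : ((0 : ℕ) : ℤ) - Int.ofNat j.succ = Int.negSucc j := by
        simp [Int.negSucc_eq]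
      rw [tripleCoeff, this]
      simp [invQPoch]
    · simp [tripleCoeff, invQPoch]
  | succ N ih =>
    have h1 := (Equiv.subRight (1 : ℤ)).hasSum_iff.mpr ih
    have h2 := (Equiv.addRight (1 : ℤ)).hasSum_iff.mpr ih
    rw [Finset.prod_range_succ]
    convert! ((ih.mul_left (1 + (q ^ (2 * N + 1)) ^ 2)).sub
      (h1.mul_left (q ^ (2 * N + 1) * z))).sub (h2.mul_left (q ^ (2 * N + 1) * z⁻¹)) using 1
    · ext n
      simp only [tripleCoeff_succ hq0 hq, Function.comp, Equiv.subRight_apply, Equiv.coe_addRight,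
        zpow_sub_one₀ hz, zpow_add_one₀ hz]
      field_simp
      ring
    · field_simp
      ring_nf

lemma exists_tendsto_qPoch {p : ℂ} (hp : ‖p‖ < 1) :
    ∃ c : ℂ, c ≠ 0 ∧ Tendsto (qPoch p) atTop (𝓝 c) := by
  have hs : Summable fun i : ℕ => ‖-p ^ (i + 1)‖ := by
    simp only [norm_neg, norm_pow]
    exact (summable_nat_add_iff 1).mpr (summable_geometric_of_lt_one (norm_nonneg _) hp)
  refine ⟨∏' i : ℕ, (1 + -p ^ (i + 1)), tprod_one_add_ne_zero_of_summable (fun i => ?_) hs, ?_⟩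
  · simpa [sub_eq_add_neg] using one_sub_pow_ne_zero hp i.succ_ne_zero
  · simpa [qPoch, sub_eq_add_neg, Function.comp_def] using!
      (multipliable_one_add_of_summable hs).hasProd.tendsto_prod_nat

lemma tendsto_invQPoch {p c : ℂ} (hc : c ≠ 0) (h : Tendsto (qPoch p) atTop (𝓝 c)) :
    Tendsto (invQPoch p) atTop (𝓝 c⁻¹) := by
  have ht : Tendsto Int.toNat atTop atTop :=
    tendsto_atTop_atTop.mpr fun b => ⟨b, fun n hn => by omega⟩
  refine ((h.inv₀ hc).comp ht).congr' ?_
  filter_upwards [eventually_ge_atTop 0] with n hn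
  obtain ⟨k, rfl⟩ := Int.eq_ofNat_of_zero_le hn
  rfl

lemma exists_norm_invQPoch_le {p c : ℂ} (hc : c ≠ 0) (h : Tendsto (qPoch p) atTop (𝓝 c)) :
    ∃ B : ℝ, ∀ n, ‖invQPoch p n‖ ≤ B := by
  obtain ⟨B, hB⟩ := (h.inv₀ hc).norm.bddAbove_range
  have hB' : ∀ k, ‖(qPoch p k)⁻¹‖ ≤ B := fun k => hB ⟨k, rfl⟩
  refine ⟨B, fun n => ?_⟩
  rcases n with k | k
  · exact hB' k
  · simpa [invQPoch] using (norm_nonneg _).trans (hB' 0)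

lemma summable_norm_zpow_sq {q : ℂ} (hq : ‖q‖ < 1) :
    Summable fun n : ℤ => ‖q ^ (n ^ 2)‖ := by
  have h : Summable fun n : ℕ => ‖q‖ ^ n :=
    summable_geometric_of_lt_one (norm_nonneg _) hq
  have h' : Summable fun n : ℕ => ‖q‖ ^ (n ^ 2) :=
    Summable.of_nonneg_of_le (fun _ => by positivity)
      (fun n => pow_le_pow_of_le_one (norm_nonneg _) hq.le (Nat.le_self_pow two_ne_zero n)) h
  refine Summable.of_nat_of_neg ?_ ?_ <;>
  · convert! h' using 2 with n
    rw [norm_zpow, ← zpow_natCast]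
    push_cast
    ring_nf

/-- A weak form of the Jacobi triple product: the product is proportional to the theta series. -/
lemma exists_tendsto_prod_theta4 {q : ℂ} (hq0 : q ≠ 0) (hq : ‖q‖ < 1) :
    ∃ c : ℂ, c ≠ 0 ∧ ∀ φ : ℝ, Tendsto (fun N : ℕ => ∏ m ∈ Finset.range N,
      (1 - q ^ (2 * m + 1) * Complex.exp (2 * Complex.I * φ)) *
        (1 - q ^ (2 * m + 1) * (Complex.exp (2 * Complex.I * φ))⁻¹)) atTop
      (𝓝 (c * theta4 φ q)) := by
  have hp : ‖q ^ 2‖ < 1 := by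
    rw [norm_pow]; exact pow_lt_one₀ (norm_nonneg _) hq two_ne_zero
  obtain ⟨c, hc0, hc⟩ := exists_tendsto_qPoch hp
  have hi := tendsto_invQPoch hc0 hc
  obtain ⟨B, hB⟩ := exists_norm_invQPoch_le hc0 hc
  obtain ⟨A, hA⟩ := hc.norm.bddAbove_range
  have hA' : ∀ k, ‖qPoch (q ^ 2) k‖ ≤ A := fun k => hA ⟨k, rfl⟩
  refine ⟨c⁻¹, inv_ne_zero hc0, fun φ => ?_⟩
  set z := Complex.exp (2 * Complex.I * φ) with hz
  have hz0 : z ≠ 0 := Complex.exp_ne_zero _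
  have hz1 : ‖z‖ = 1 := by
    rw [hz, show 2 * Complex.I * (φ : ℂ) = ((2 * φ : ℝ) : ℂ) * Complex.I by push_cast; ring,
      Complex.norm_exp_ofReal_mul_I]
  simp only [fun N => (hasSum_tripleCoeff hq0 hq hz0 N).tsum_eq.symm]
  rw [theta4, ← tsum_mul_left]
  refine tendsto_tsum_of_dominated_convergence (bound := fun n : ℤ => ‖q ^ (n ^ 2)‖ * (A * (B * B)))
    ((summable_norm_zpow_sq hq).mul_right _) (fun n => ?_) (Eventually.of_forall fun N n => ?_)
  · have hN : Tendsto (fun N : ℕ => (N : ℤ)) atTop atTop := tendsto_natCast_atTop_atTop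
    have h1 := hi.comp (tendsto_atTop_add_const_right _ n hN)
    have h2 := hi.comp (tendsto_atTop_add_const_right _ (-n) hN)
    have h3 := hc.comp (tendsto_id.const_mul_atTop' (two_pos : 0 < 2))
    have h4 := (((h3.const_mul ((-1) ^ n * q ^ (n ^ 2))).mul (h1.mul h2)).mul_const (z ^ n))
    convert! h4 using 2
    rw [hz, ← Complex.exp_int_mul]
    rw [show 2 * Complex.I * n * (φ : ℂ) = n * (2 * Complex.I * φ) by ring]
    field_simp
  · simp only [tripleCoeff, norm_mul, norm_zpow, hz1, one_zpow, mul_one, norm_neg, norm_one,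
      one_mul]
    have hB0 := (norm_nonneg _).trans (hB 0)
    have hA0 := (norm_nonneg _).trans (hA' 0)
    rw [mul_assoc]
    gcongr
    exacts [hA' _, hB _, hB _]

/-- The Fourier coefficients of `log ϑ₄(φ, q)`. -/
noncomputable def logThetaCoeff (q : ℝ) (n : ℕ) : ℝ :=
  -2 * q ^ (n + 1) / ((n + 1) * (1 - q ^ (2 * (n + 1))))

/-- The Fourier series of `log ϑ₄(φ, q)`, without its constant term. -/
noncomputable def logTheta (q φ : ℝ) : ℝ :=
  ∑' n : ℕ, logThetaCoeff q n * Real.cos (2 * ((n : ℝ) + 1) * φ)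

lemma summable_logTheta_double {q : ℝ} (hq0 : 0 < q) (hq1 : q < 1) (φ : ℝ) :
    Summable fun x : ℕ × ℕ => (-2 * (q ^ (2 * x.1 + 1)) ^ (x.2 + 1) / (x.2 + 1) : ℝ) *
      Real.cos (2 * ((x.2 : ℝ) + 1) * φ) := by
  have hg := summable_geometric_of_lt_one hq0.le hq1
  have h := (hg.mul_of_nonneg hg (fun _ => by positivity) (fun _ => by positivity)).mul_left 2
  refine Summable.of_norm_bounded h fun x => ?_
  rw [norm_mul, norm_div, norm_mul, Real.norm_eq_abs (Real.cos _)]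
  have h1 : ‖(q ^ (2 * x.1 + 1)) ^ (x.2 + 1)‖ ≤ q ^ x.1 * q ^ x.2 := by
    rw [Real.norm_of_nonneg (by positivity), ← pow_mul, ← pow_add]
    exact pow_le_pow_of_le_one hq0.le hq1.le (by nlinarith)
  have h2 : (1 : ℝ) ≤ ‖(x.2 : ℝ) + 1‖ := by
    rw [Real.norm_of_nonneg (by positivity)]
    simp
  calc _ ≤ ‖(-2 : ℝ)‖ * ‖(q ^ (2 * x.1 + 1)) ^ (x.2 + 1)‖ * 1 := by
        gcongr
        · exact div_le_self (by positivity) h2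
        · exact Real.abs_cos_le_one _
    _ ≤ 2 * (q ^ x.1 * q ^ x.2) := by
        rw [mul_one, norm_neg, Real.norm_two]
        gcongr

lemma hasSum_log_factor {r : ℝ} (hr0 : 0 < r) (hr1 : r < 1) (φ : ℝ) :
    HasSum (fun n : ℕ => (((-2 * r ^ (n + 1) / (n + 1) : ℝ) *
        Real.cos (2 * ((n : ℝ) + 1) * φ) : ℝ) : ℂ))
      (Complex.log (1 - r * Complex.exp (2 * Complex.I * φ)) +
        Complex.log (1 - r * (Complex.exp (2 * Complex.I * φ))⁻¹)) := by
  have hz1 : ‖Complex.exp (2 * Complex.I * φ)‖ = 1 := by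
    rw [show 2 * Complex.I * (φ : ℂ) = ((2 * φ : ℝ) : ℂ) * Complex.I by push_cast; ring,
      Complex.norm_exp_ofReal_mul_I]
  have hr : ‖(r : ℂ)‖ < 1 := by rwa [Complex.norm_real, Real.norm_of_nonneg hr0.le]
  have h1 := Complex.hasSum_taylorSeries_neg_log' (z := r * Complex.exp (2 * Complex.I * φ))
    (by rwa [norm_mul, hz1, mul_one])
  have h2 := Complex.hasSum_taylorSeries_neg_log' (z := r * (Complex.exp (2 * Complex.I * φ))⁻¹)
    (by rwa [norm_mul, norm_inv, hz1, inv_one, mul_one])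
  convert! (h1.add h2).neg using 1
  · ext n
    push_cast
    rw [mul_pow, mul_pow, ← Complex.exp_neg, ← Complex.exp_nat_mul, ← Complex.exp_nat_mul,
      Complex.cos]
    rw [show 2 * ((n : ℂ) + 1) * φ * Complex.I = ((n + 1 : ℕ) : ℂ) * (2 * Complex.I * φ) by
      push_cast; ring, show -(2 * ((n : ℂ) + 1) * φ) * Complex.I =
        ((n + 1 : ℕ) : ℂ) * -(2 * Complex.I * φ) by push_cast; ring]
    ring
  · ring

lemma hasSum_geometric_odd {q : ℝ} (hq0 : 0 < q) (hq1 : q < 1) (n : ℕ) :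
    HasSum (fun m : ℕ => (q ^ (2 * m + 1)) ^ (n + 1))
      (q ^ (n + 1) / (1 - q ^ (2 * (n + 1)))) := by
  rw [div_eq_mul_inv]
  have h := (hasSum_geometric_of_lt_one (pow_nonneg hq0.le (2 * (n + 1)))
    (pow_lt_one₀ hq0.le hq1 (by omega))).mul_left (q ^ (n + 1))
  convert! h using 2 with m
  ring

lemma hasSum_log_factors {q : ℝ} (hq0 : 0 < q) (hq1 : q < 1) (φ : ℝ) :
    HasSum (fun m : ℕ =>
      Complex.log (1 - (q : ℂ) ^ (2 * m + 1) * Complex.exp (2 * Complex.I * φ)) +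
        Complex.log (1 - (q : ℂ) ^ (2 * m + 1) * (Complex.exp (2 * Complex.I * φ))⁻¹))
      (logTheta q φ) := by
  have hs := summable_logTheta_double hq0 hq1 φ
  have h1 := (Complex.hasSum_ofReal.mpr hs.hasSum).prod_fiberwise fun m =>
    hasSum_log_factor (pow_pos hq0 (2 * m + 1)) (pow_lt_one₀ hq0.le hq1 (by omega)) φ
  have h2 := ((Equiv.prodComm ℕ ℕ).hasSum_iff.mpr hs.hasSum).prod_fiberwise fun n =>
    (((hasSum_geometric_odd hq0 hq1 n).mul_left (-2)).div_const ((n : ℝ) + 1)).mul_right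
      (Real.cos (2 * ((n : ℝ) + 1) * φ))
  have h3 : logTheta q φ = ∑' x : ℕ × ℕ, (-2 * (q ^ (2 * x.1 + 1)) ^ (x.2 + 1) / (x.2 + 1) : ℝ) *
      Real.cos (2 * ((x.2 : ℝ) + 1) * φ) := by
    refine Eq.trans (tsum_congr fun n => ?_) h2.tsum_eq
    rw [logThetaCoeff]
    congr 1
    rw [mul_comm ((n : ℝ) + 1), ← div_div, mul_div_assoc]
  rw [h3]
  simpa only [Complex.ofReal_pow] using h1

lemma exists_theta4_eq_exp {q : ℝ} (hq0 : 0 < q) (hq1 : q < 1) :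
    ∃ c : ℂ, c ≠ 0 ∧ ∀ φ : ℝ, c * theta4 φ q = Complex.exp (logTheta q φ) := by
  have hq : ‖(q : ℂ)‖ < 1 := by rwa [Complex.norm_real, Real.norm_of_nonneg hq0.le]
  obtain ⟨c, hc, h⟩ := exists_tendsto_prod_theta4 (Complex.ofReal_ne_zero.mpr hq0.ne') hq
  refine ⟨c, hc, fun φ => tendsto_nhds_unique (h φ) ?_⟩
  have h1 := (Complex.continuous_exp.tendsto _).comp
    (hasSum_log_factors hq0 hq1 φ).tendsto_sum_nat
  refine h1.congr fun N => ?_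
  have hz1 : ‖Complex.exp (2 * Complex.I * φ)‖ = 1 := by
    rw [show 2 * Complex.I * (φ : ℂ) = ((2 * φ : ℝ) : ℂ) * Complex.I by push_cast; ring,
      Complex.norm_exp_ofReal_mul_I]
  have hne : ∀ (m : ℕ) (w : ℂ), ‖w‖ = 1 → 1 - (q : ℂ) ^ (2 * m + 1) * w ≠ 0 := by
    intro m w hw h0
    have : ‖(q : ℂ) ^ (2 * m + 1) * w‖ < 1 := by
      rw [norm_mul, hw, mul_one, norm_pow]
      exact pow_lt_one₀ (norm_nonneg _) hq (by omega)
    rw [← sub_eq_zero.mp h0] at this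
    simp at this
  rw [Function.comp_apply, Complex.exp_sum]
  refine Finset.prod_congr rfl fun m _ => ?_
  rw [Complex.exp_add, Complex.exp_log (hne m _ hz1),
    Complex.exp_log (hne m _ (by rw [norm_inv, hz1, inv_one]))]

lemma log_theta4_div {q : ℝ} (hq0 : 0 < q) (hq1 : q < 1) (φ : ℝ) :
    Complex.log (theta4 φ q / theta4 0 q) = ((logTheta q φ - logTheta q 0 : ℝ) : ℂ) := by
  obtain ⟨c, hc, h⟩ := exists_theta4_eq_exp hq0 hq1
  have h0 := h 0
  rw [Complex.ofReal_zero] at h0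
  rw [← mul_div_mul_left _ _ hc, h, h0, ← Complex.exp_sub, ← Complex.ofReal_sub,
    ← Complex.ofReal_exp, ← Complex.ofReal_log (Real.exp_pos _).le, Real.log_exp]

lemma summable_logThetaCoeff {q : ℝ} (hq0 : 0 < q) (hq1 : q < 1) :
    Summable fun n => ‖logThetaCoeff q n‖ := by
  have h := (((summable_logTheta_double hq0 hq1 0).prod_symm).prod).norm
  convert! h using 3 with n
  simp only [Prod.swap]
  rw [((((hasSum_geometric_odd hq0 hq1 n).mul_left (-2)).div_const ((n : ℝ) + 1)).mul_right
    (Real.cos (2 * ((n : ℝ) + 1) * 0))).tsum_eq, logThetaCoeff, mul_zero, Real.cos_zero, mul_one,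
    mul_comm ((n : ℝ) + 1), ← div_div, mul_div_assoc]

lemma hasSum_integral_cos_mul {b : ℕ → ℂ} (hb : Summable fun n => ‖b n‖) {h : ℝ → ℂ}
    (hh : Continuous h) :
    HasSum (fun n : ℕ => b n * ∫ φ in (0 : ℝ)..Real.pi,
        (Real.cos (2 * ((n : ℝ) + 1) * φ) : ℂ) * h φ)
      (∫ φ in (0 : ℝ)..Real.pi,
        (∑' n : ℕ, b n * (Real.cos (2 * ((n : ℝ) + 1) * φ) : ℂ)) * h φ) := by
  simp only [← intervalIntegral.integral_const_mul, ← tsum_mul_right]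
  have hbd : ∀ (n : ℕ) (φ : ℝ),
      ‖b n * ((Real.cos (2 * ((n : ℝ) + 1) * φ) : ℂ) * h φ)‖ ≤ ‖b n‖ * ‖h φ‖ := by
    intro n φ
    rw [norm_mul, norm_mul, Complex.norm_real]
    gcongr
    exact mul_le_of_le_one_left (norm_nonneg _) (Real.abs_cos_le_one _)
  simp only [mul_assoc (b _)]
  refine intervalIntegral.hasSum_integral_of_dominated_convergence
    (fun n φ => ‖b n‖ * ‖h φ‖) (fun n => ?_) (fun n => ?_) ?_ ?_ ?_
  · exact Continuous.aestronglyMeasurable (by fun_prop)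
  · exact Eventually.of_forall fun φ _ => hbd n φ
  · exact Eventually.of_forall fun φ _ => hb.mul_right _
  · simp only [tsum_mul_right]
    exact Continuous.intervalIntegrable (by fun_prop) _ _
  · exact Eventually.of_forall fun φ _ =>
      (Summable.of_norm_bounded (hb.mul_right _) fun n => hbd n φ).hasSum

lemma integral_cos_two_int_mul {k : ℤ} (hk : k ≠ 0) :
    ∫ φ in (0 : ℝ)..Real.pi, Real.cos (2 * (k : ℝ) * φ) = 0 := by
  have hk' : (k : ℝ) ≠ 0 := by exact_mod_cast hk
  rw [intervalIntegral.integral_comp_mul_left (fun x => Real.cos x) (by positivity),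
    integral_cos, mul_zero, Real.sin_zero, sub_zero,
    show 2 * (k : ℝ) * Real.pi = ((2 * k : ℤ) : ℝ) * Real.pi by push_cast; ring,
    Real.sin_int_mul_pi, smul_zero]

lemma integral_cos_mul_cos (m n : ℕ) :
    ∫ φ in (0 : ℝ)..Real.pi, Real.cos (2 * ((m : ℝ) + 1) * φ) * Real.cos (2 * ((n : ℝ) + 1) * φ) =
      if m = n then Real.pi / 2 else 0 := by
  have h : ∀ φ : ℝ, Real.cos (2 * ((m : ℝ) + 1) * φ) * Real.cos (2 * ((n : ℝ) + 1) * φ) =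
      (Real.cos (2 * ((m - n : ℤ) : ℝ) * φ) + Real.cos (2 * ((m + n + 2 : ℤ) : ℝ) * φ)) / 2 := by
    intro φ
    have := Real.two_mul_cos_mul_cos (2 * ((m : ℝ) + 1) * φ) (2 * ((n : ℝ) + 1) * φ)
    rw [eq_div_iff two_ne_zero, mul_comm, ← mul_assoc, this]
    push_cast
    ring_nf
  simp only [h]
  rw [intervalIntegral.integral_div, intervalIntegral.integral_add
    (Continuous.intervalIntegrable (by fun_prop) _ _)
    (Continuous.intervalIntegrable (by fun_prop) _ _),
    integral_cos_two_int_mul (k := m + n + 2) (by omega)]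
  split_ifs with hmn
  · simp [hmn]
  · rw [integral_cos_two_int_mul (by omega)]
    simp

lemma continuous_logTheta {q : ℝ} (hq0 : 0 < q) (hq1 : q < 1) : Continuous (logTheta q) := by
  refine continuous_tsum (fun n => by fun_prop) (summable_logThetaCoeff hq0 hq1) fun n φ => ?_
  rw [norm_mul]
  exact mul_le_of_le_one_right (norm_nonneg _) (Real.abs_cos_le_one _)

lemma integral_cos_mul_logTheta {q : ℝ} (hq0 : 0 < q) (hq1 : q < 1) (n : ℕ) :
    ∫ φ in (0 : ℝ)..Real.pi, (Real.cos (2 * ((n : ℝ) + 1) * φ) : ℂ) *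
      ((logTheta q φ - logTheta q 0 : ℝ) : ℂ) = (Real.pi / 2 * logThetaCoeff q n : ℝ) := by
  have hb : Summable fun n => ‖(logThetaCoeff q n : ℂ)‖ := by
    simpa only [Complex.norm_real] using summable_logThetaCoeff hq0 hq1
  have h1 := hasSum_integral_cos_mul hb
    (h := fun φ => (Real.cos (2 * ((n : ℝ) + 1) * φ) : ℂ)) (by fun_prop)
  have h2 := h1.unique (hasSum_single n fun m hm => by
    simp only [← Complex.ofReal_mul]
    rw [intervalIntegral.integral_ofReal, integral_cos_mul_cos, if_neg hm]
    simp)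
  simp only [← Complex.ofReal_mul, ← Complex.ofReal_tsum] at h2
  rw [intervalIntegral.integral_ofReal, intervalIntegral.integral_ofReal, integral_cos_mul_cos,
    if_pos rfl, ← Complex.ofReal_mul, Complex.ofReal_inj] at h2
  simp only [← Complex.ofReal_mul]
  rw [intervalIntegral.integral_ofReal, Complex.ofReal_inj]
  have hc := continuous_logTheta hq0 hq1
  have h3 := integral_cos_two_int_mul (k := n + 1) (by omega)
  push_cast at h3
  simp only [mul_sub]
  rw [intervalIntegral.integral_sub (Continuous.intervalIntegrable (by fun_prop) _ _)
    (Continuous.intervalIntegrable (by fun_prop) _ _), intervalIntegral.integral_mul_const, h3,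
    zero_mul, sub_zero, mul_comm (Real.pi / 2), ← h2]
  simp only [mul_comm (Real.cos _), logTheta]

/-- For `0 < q < 1` and `Σ |aₙ| < ∞`, with `g(φ) = Σ_{n≥1} aₙ cos(2nφ)`:
`∫₀^π g(φ) log(ϑ₄(φ,q)/ϑ₄(0,q)) dφ = -π Σ_{n≥1} aₙ qⁿ/(n(1-q^{2n}))`. -/
theorem stmt7 (q : ℝ) (hq0 : 0 < q) (hq1 : q < 1) (a : ℕ → ℂ)
    (ha : Summable fun n : ℕ => ‖a (n + 1)‖) :
    ∫ φ in (0 : ℝ)..Real.pi,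
        (∑' n : ℕ, a (n + 1) * (Real.cos (2 * ((n : ℝ) + 1) * φ) : ℂ)) *
          Complex.log (theta4 (φ : ℂ) (q : ℂ) / theta4 0 (q : ℂ)) =
      -(Real.pi : ℂ) *
        ∑' n : ℕ, a (n + 1) * (q : ℂ) ^ (n + 1) /
          (((n : ℂ) + 1) * (1 - (q : ℂ) ^ (2 * (n + 1)))) := by
  have hc := continuous_logTheta hq0 hq1
  simp only [log_theta4_div hq0 hq1]
  rw [← (hasSum_integral_cos_mul ha
    (h := fun φ => ((logTheta q φ - logTheta q 0 : ℝ) : ℂ)) (by fun_prop)).tsum_eq,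
    ← tsum_mul_left]
  refine tsum_congr fun n => ?_
  rw [integral_cos_mul_logTheta hq0 hq1, logThetaCoeff]
  push_cast
  ring
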